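/- Let 0 < α < β, let p = (p₁,…,p_l), q = (q₁,…,q_l) be vectors with positive entries such that q_j/p_j ∈ [α,β] for all j, and let R = (r_{ij}) ∈ M_{m×l}(ℝ) be a column stochastic matrix with ⟨p,r_i⟩ := Σ_{j=1}^l p_j r_{ij} > 0 and ⟨q,r_i⟩ := Σ_{j=1}^l q_j r_{ij} for i = 1,…,m. Then for every f : [α,β] → ℝ strongly convex with modulus c > 0, Σ_{j=1}^l p_j f(q_j/p_j) ≤ ((Σ_{i=1}^m ⟨p,r_i⟩ β − Σ_{j=1}^l q_j)/(β − α)) f(α) + ((Σ_{j=1}^l q_j − Σ_{i=1}^m ⟨p,r_i⟩ α)/(β − α)) f(β) − c Σ_{j=1}^l p_j (β − q_j/p_j)(q_j/p_j − α). -/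

import Mathlib

/-- The chord bound for a strongly convex function on an interval. -/
theorem strongly_convex_le_chord {α β c : ℝ} (hαβ : α < β) {f : ℝ → ℝ}
    (hf : ∀ u ∈ Set.Icc α β, ∀ v ∈ Set.Icc α β, ∀ t ∈ Set.Icc (0:ℝ) 1,
      f (t * u + (1 - t) * v) ≤ t * f u + (1 - t) * f v - c * t * (1 - t) * (u - v) ^ 2)
    {x : ℝ} (hx : x ∈ Set.Icc α β) :
    f x ≤ (β - x) / (β - α) * f α + (x - α) / (β - α) * f β - c * ((β - x) * (x - α)) := by
  have hd : 0 < β - α := sub_pos.2 hαβ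
  have hd' : β - α ≠ 0 := hd.ne'
  have h := hf α (Set.left_mem_Icc.2 hαβ.le) β (Set.right_mem_Icc.2 hαβ.le)
    ((β - x) / (β - α))
    ⟨div_nonneg (sub_nonneg.2 hx.2) hd.le, (div_le_one hd).2 (by linarith [hx.1])⟩
  have h1 : 1 - (β - x) / (β - α) = (x - α) / (β - α) := by
    field_simp
    ring
  rw [h1] at h
  have h2 : (β - x) / (β - α) * α + (x - α) / (β - α) * β = x := by
    field_simp
    ring
  have h3 : c * ((β - x) / (β - α)) * ((x - α) / (β - α)) * (α - β) ^ 2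
      = c * ((β - x) * (x - α)) := by
    rw [← neg_sub β α, neg_sq]
    field_simp
  rwa [h2, h3] at h

/-- Converse Sherman-type upper bound for the generalized f-divergence. -/
theorem f_divergence_converse_sherman_strongly_convex
    (α β : ℝ) (hα : 0 < α) (hαβ : α < β) (l m : ℕ)
    (p q : Fin l → ℝ) (hp : ∀ j, 0 < p j) (hq : ∀ j, 0 < q j)
    (hqp : ∀ j, q j / p j ∈ Set.Icc α β)
    (R : Fin m → Fin l → ℝ) (hR : ∀ i j, 0 ≤ R i j) (hRcol : ∀ j, ∑ i, R i j = 1)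
    (hpr : ∀ i, 0 < ∑ j, p j * R i j)
    (f : ℝ → ℝ) (c : ℝ) (hc : 0 < c)
    (hf : ∀ u ∈ Set.Icc α β, ∀ v ∈ Set.Icc α β, ∀ t ∈ Set.Icc (0:ℝ) 1,
      f (t * u + (1 - t) * v) ≤ t * f u + (1 - t) * f v - c * t * (1 - t) * (u - v) ^ 2) :
    ∑ j, p j * f (q j / p j) ≤
      (((∑ i, ∑ j, p j * R i j) * β - ∑ j, q j) / (β - α)) * f α
        + (((∑ j, q j) - (∑ i, ∑ j, p j * R i j) * α) / (β - α)) * f β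
        - c * ∑ j, p j * (β - q j / p j) * (q j / p j - α) := by
  have hS : ∑ i, ∑ j, p j * R i j = ∑ j, p j := by
    rw [Finset.sum_comm]
    simp [← Finset.mul_sum, hRcol]
  rw [hS]
  calc ∑ j, p j * f (q j / p j)
      ≤ ∑ j, ((p j * β - q j) / (β - α) * f α + (q j - p j * α) / (β - α) * f β
          - c * (p j * (β - q j / p j) * (q j / p j - α))) := by
        refine Finset.sum_le_sum fun j _ => ?_
        have hj : p j * (q j / p j) = q j := mul_div_cancel₀ _ (hp j).ne'
        have h := mul_le_mul_of_nonneg_left (strongly_convex_le_chord hαβ hf (hqp j)) (hp j).le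
        refine h.trans_eq ?_
        generalize q j / p j = x at hj
        rw [← hj]
        ring
    _ = _ := by
        simp only [Finset.sum_sub_distrib, Finset.sum_add_distrib, ← Finset.sum_mul,
          ← Finset.mul_sum, ← Finset.sum_div]
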